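/- arXiv:2507.00213 — 4 statements merged into one kernel-verified Lean document; each statement's English description precedes it below -/
import Mathlib

section
/- The Möbius ladder M4 on 8 vertices contains exactly five Hamiltonian cycles (as edge sets): one consisting of all eight horizontal edges, and four each omitting a pair of consecutive rungs and exactly two horizontal edges. -/
open SimpleGraph

/-- The Möbius ladder on 8 vertices: cycle edges `{i, i+1}` and rungs `{i, i+4}`. -/
def M4 : SimpleGraph (Fin 8) :=
  SimpleGraph.fromRel (fun i j => j = i + 1 ∨ j = i + 4)

/-- An edge of `M4` is a rung if it has the form `{i, i+4}`. -/
def IsRung (e : Sym2 (Fin 8)) : Prop := ∃ i : Fin 8, e = s(i, i + 4)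

/-- An edge of `M4` is horizontal if it has the form `{i, i+1}`. -/
def IsHorizontal (e : Sym2 (Fin 8)) : Prop := ∃ i : Fin 8, e = s(i, i + 1)

/-- `E` is the edge set of a Hamiltonian cycle of `M4`. -/
def IsHamEdgeSet (E : Set (Sym2 (Fin 8))) : Prop :=
  ∃ (v : Fin 8) (w : M4.Walk v v), w.IsHamiltonianCycle ∧ E = {e | e ∈ w.edges}

instance : DecidableRel M4.Adj :=
  inferInstanceAs (DecidableRel (SimpleGraph.fromRel _).Adj)

/-- The vertex lists of the walks of length `n` in `M4` starting at `u` whose later vertices are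
pairwise distinct and avoid the list `avoid`. -/
def avoidingWalks : ℕ → List (Fin 8) → Fin 8 → List (List (Fin 8))
  | 0, _, u => [[u]]
  | n + 1, avoid, u =>
    (([u + 1, u + 4, u + 7].filter (· ∉ avoid)).flatMap
      fun v => avoidingWalks n (v :: avoid) v).map (u :: ·)

/-- The set of edges joining consecutive vertices of a list. -/
def edgesOfList (l : List (Fin 8)) : Finset (Sym2 (Fin 8)) :=
  (List.zipWith (s(·, ·)) l l.tail).toFinset

/-- The edge set of the outer cycle. -/
def outerEdges : Finset (Sym2 (Fin 8)) := Finset.univ.image fun i => s(i, i + 1)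

/-- The cycle through the rungs at `i` and `i + 1`, as a vertex list. -/
def twoRungCycle (i : Fin 8) : List (Fin 8) :=
  [i, i + 4, i + 3, i + 2, i + 1, i + 5, i + 6, i + 7, i]

/-- Vertex lists of representatives of the Hamiltonian cycles of `M4`. -/
def hamCycleLists : List (List (Fin 8)) :=
  [0, 1, 2, 3, 4, 5, 6, 7, 0] :: [0, 1, 2, 3].map twoRungCycle

/-- The edge sets of the Hamiltonian cycles of `M4`. -/
def hamEdgeSets : Finset (Finset (Sym2 (Fin 8))) :=
  (hamCycleLists.map edgesOfList).toFinset

lemma M4_adj_mem_neighbors : ∀ {u v : Fin 8}, M4.Adj u v → v ∈ [u + 1, u + 4, u + 7] := by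
  decide

lemma support_mem_avoidingWalks {u v : Fin 8} (w : M4.Walk u v) (avoid : List (Fin 8))
    (hnodup : w.support.tail.Nodup) (havoid : ∀ x ∈ w.support.tail, x ∉ avoid) :
    w.support ∈ avoidingWalks w.length avoid u := by
  induction w generalizing avoid with
  | nil => simp [avoidingWalks]
  | @cons a b c h p ih =>
    rw [Walk.support_cons, List.tail_cons] at hnodup havoid
    rw [← Walk.cons_tail_support p] at hnodup havoid
    rw [List.nodup_cons] at hnodup
    rw [Walk.support_cons, Walk.length_cons, avoidingWalks]
    refine List.mem_map_of_mem (List.mem_flatMap.2 ⟨b, ?_, ih _ hnodup.2 ?_⟩)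
    · simpa only [List.mem_filter, decide_eq_true_eq] using
        ⟨M4_adj_mem_neighbors h, havoid b List.mem_cons_self⟩
    · intro x hx hmem
      rcases List.mem_cons.1 hmem with rfl | hmem
      · exact hnodup.1 hx
      · exact havoid x (List.mem_cons_of_mem _ hx) hmem

lemma edgesOfList_mem_hamEdgeSets :
    ∀ l ∈ avoidingWalks 8 [] 0, l.getLast? = some 0 → edgesOfList l ∈ hamEdgeSets := by
  decide +kernel

lemma coe_edgesOfList_support {u v : Fin 8} (w : M4.Walk u v) :
    (edgesOfList w.support : Set (Sym2 (Fin 8))) = {e | e ∈ w.edges} := by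
  ext e
  simp [edgesOfList, Walk.edges_eq_zipWith_support]

lemma IsHamEdgeSet.exists_mem_hamEdgeSets {E : Set (Sym2 (Fin 8))} (hE : IsHamEdgeSet E) :
    ∃ S ∈ hamEdgeSets, (S : Set (Sym2 (Fin 8))) = E := by
  obtain ⟨v, w, hw, rfl⟩ := hE
  have h0 := hw.mem_support 0
  have hr := hw.rotate h0
  refine ⟨_, edgesOfList_mem_hamEdgeSets (w.rotate 0 h0).support ?_ ?_, ?_⟩
  · have := support_mem_avoidingWalks (w.rotate 0 h0) [] hr.isCycle.support_nodup (by simp)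
    rwa [hr.length_eq, Fintype.card_fin] at this
  · rw [List.getLast?_eq_getLast_of_ne_nil (Walk.support_ne_nil _), Walk.getLast_support]
  · rw [coe_edgesOfList_support]
    ext e
    exact (w.rotate_edges 0 h0).mem_iff

lemma isHamEdgeSet_edges {u v : Fin 8} (w : M4.Walk u v) (huv : u = v)
    (hedges : (List.zipWith (s(·, ·)) w.support w.support.tail).Nodup)
    (htail : ∀ a, w.support.tail.count a = 1) :
    IsHamEdgeSet {e | e ∈ w.edges} := by
  subst huv
  refine ⟨u, w, ?_, rfl⟩
  rw [Walk.isHamiltonianCycle_iff_isCycle_and_support_count_tail_eq_one]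
  refine ⟨(Walk.isCycle_def w).2 ⟨?_, ?_, ?_⟩, htail⟩
  · rwa [Walk.isTrail_def, Walk.edges_eq_zipWith_support]
  · rintro rfl
    simpa using htail u
  · exact List.nodup_iff_count_le_one.2 fun a => (htail a).le

lemma isHamEdgeSet_of_mem_hamEdgeSets {S : Finset (Sym2 (Fin 8))} (hS : S ∈ hamEdgeSets) :
    IsHamEdgeSet S := by
  obtain ⟨l, hl, rfl⟩ := List.mem_map.1 (List.mem_toFinset.1 hS)
  have key : ∀ l ∈ hamCycleLists, ∃ hne : l ≠ [], l.IsChain M4.Adj ∧ l.head hne = l.getLast hne ∧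
      (List.zipWith (s(·, ·)) l l.tail).Nodup ∧ ∀ a, l.tail.count a = 1 := by
    decide +kernel
  obtain ⟨hne, hchain, hends, hedges, htail⟩ := key l hl
  have h := isHamEdgeSet_edges (Walk.ofSupport l hne hchain) hends
    (by rwa [Walk.support_ofSupport]) (by rwa [Walk.support_ofSupport])
  rwa [← coe_edgesOfList_support, Walk.support_ofSupport] at h

lemma isHamEdgeSet_iff {E : Set (Sym2 (Fin 8))} :
    IsHamEdgeSet E ↔ ∃ S ∈ hamEdgeSets, (S : Set (Sym2 (Fin 8))) = E :=
  ⟨fun h => h.exists_mem_hamEdgeSets, by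
    rintro ⟨S, hS, rfl⟩
    exact isHamEdgeSet_of_mem_hamEdgeSets hS⟩

lemma setOf_isHorizontal : {e | IsHorizontal e} = (outerEdges : Set (Sym2 (Fin 8))) := by
  ext e
  simp [IsHorizontal, outerEdges, eq_comm]

lemma exists_consecutive_rungs_notMem {S : Finset (Sym2 (Fin 8))} (hS : S ∈ hamEdgeSets)
    (hne : S ≠ outerEdges) :
    ∃ i : Fin 8, s(i, i + 4) ∉ S ∧ s(i + 1, i + 5) ∉ S ∧ (outerEdges \ S).card = 2 := by
  obtain ⟨l, hl, rfl⟩ := List.mem_map.1 (List.mem_toFinset.1 hS)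
  have outer : edgesOfList [0, 1, 2, 3, 4, 5, 6, 7, 0] = outerEdges := by
    decide +kernel
  have twoRung : ∀ i ∈ ([0, 1, 2, 3] : List (Fin 8)),
      s(i + 2, i + 2 + 4) ∉ edgesOfList (twoRungCycle i) ∧
      s(i + 2 + 1, i + 2 + 5) ∉ edgesOfList (twoRungCycle i) ∧
      (outerEdges \ edgesOfList (twoRungCycle i)).card = 2 := by
    decide +kernel
  rcases List.mem_cons.1 hl with rfl | hl
  · exact absurd outer hne
  · obtain ⟨i, hi, rfl⟩ := List.mem_map.1 hl
    exact ⟨i + 2, twoRung i hi⟩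

/-- `M4` contains exactly five Hamiltonian cycles (as edge sets): the outer cycle of all
eight horizontal edges, and four cycles each omitting a pair of consecutive rungs and
exactly two horizontal edges. -/
theorem ham_cycles_exactly_five :
    {E : Set (Sym2 (Fin 8)) | IsHamEdgeSet E}.ncard = 5 ∧
    IsHamEdgeSet {e | IsHorizontal e} ∧
    (∀ E : Set (Sym2 (Fin 8)), IsHamEdgeSet E → E ≠ {e | IsHorizontal e} →
      ∃ i : Fin 8, s(i, i + 4) ∉ E ∧ s(i + 1, i + 5) ∉ E ∧
        {e | IsHorizontal e ∧ e ∉ E}.ncard = 2) := by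
  refine ⟨?_, ?_, ?_⟩
  · have himage : {E : Set (Sym2 (Fin 8)) | IsHamEdgeSet E} =
        (fun S : Finset (Sym2 (Fin 8)) => (S : Set (Sym2 (Fin 8)))) '' hamEdgeSets := by
      ext E
      exact isHamEdgeSet_iff
    rw [himage, Set.ncard_image_of_injective _ Finset.coe_injective, Set.ncard_coe_finset]
    decide +kernel
  · rw [setOf_isHorizontal]
    exact isHamEdgeSet_of_mem_hamEdgeSets (by decide +kernel)
  · intro E hE hne
    obtain ⟨S, hS, rfl⟩ := hE.exists_mem_hamEdgeSets
    rw [setOf_isHorizontal, Ne, Finset.coe_inj] at hne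
    obtain ⟨i, h₁, h₂, hcard⟩ := exists_consecutive_rungs_notMem hS hne
    refine ⟨i, h₁, h₂, ?_⟩
    have hdiff : {e | IsHorizontal e ∧ e ∉ (S : Set (Sym2 (Fin 8)))} =
        ((outerEdges \ S : Finset (Sym2 (Fin 8))) : Set (Sym2 (Fin 8))) := by
      rw [Finset.coe_sdiff, ← setOf_isHorizontal]
      rfl
    rw [hdiff, Set.ncard_coe_finset, hcard]
end

section
/- In a finite cubic graph, every edge is contained in an even number of Hamiltonian cycles. -/
open SimpleGraph

/-- The edge sets of Hamiltonian cycles of a graph `G`. -/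
def HamSets {V : Type*} [Fintype V] [DecidableEq V] (G : SimpleGraph V) :
    Set (Set (Sym2 V)) :=
  {E | ∃ (v : V) (w : G.Walk v v), w.IsHamiltonianCycle ∧ E = {e | e ∈ w.edges}}

/-- `q` lists the vertices of a Hamiltonian path of `G - x` whose last vertex is `y`. -/
structure IsHamPathAvoiding {V : Type*} (G : SimpleGraph V) (x y : V) (q : List V) : Prop where
  isChain : q.IsChain G.Adj
  nodup : q.Nodup
  mem_iff : ∀ v, v ∈ q ↔ v ≠ x
  getLast? : q.getLast? = some y

/-- Reverse the part of the list `q` before the first occurrence of `w`. -/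
def List.reverseBefore {V : Type*} [DecidableEq V] (w : V) (q : List V) : List V :=
  (q.takeWhile (· ≠ w)).reverse ++ q.dropWhile (· ≠ w)

theorem List.reverseBefore_append_cons {V : Type*} [DecidableEq V] {w : V} {b : List V}
    (hb : w ∉ b) (a : List V) : (b ++ w :: a).reverseBefore w = b.reverse ++ w :: a := by
  have h : ∀ v ∈ b, decide (v ≠ w) = true := by grind
  rw [List.reverseBefore, List.takeWhile_append_of_pos h, List.dropWhile_append_of_pos h]
  simp

/-- Reversing the part of `z :: p :: t` before `w` changes nothing only for `w = p`. -/
theorem List.reverseBefore_eq_self_iff {V : Type*} [DecidableEq V] {w z p : V} {t : List V}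
    (hn : (z :: p :: t).Nodup) (hw : w ∈ p :: t) :
    (z :: p :: t).reverseBefore w = z :: p :: t ↔ w = p := by
  constructor
  · intro h
    by_contra hne
    have hwt : w ∈ t := by grind
    obtain ⟨b, a, rfl⟩ := List.append_of_mem hwt
    have hb' : w ∉ z :: p :: b := by grind
    have h1 := List.reverseBefore_append_cons hb' a
    simp only [List.cons_append] at h1
    rw [h1, ← List.cons_append, ← List.cons_append, List.append_cancel_right_eq] at h
    have h2 := congrArg List.getLast? h
    rw [List.getLast?_reverse, List.head?_cons, List.getLast?_cons_cons] at h2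
    have h3 : z ∈ p :: b := List.mem_of_getLast? h2.symm
    grind
  · rintro rfl
    have : w ∉ [z] := by grind
    simpa using List.reverseBefore_append_cons this t

namespace IsHamPathAvoiding

variable {V : Type*} {G : SimpleGraph V} {x y : V}

/-- The two halves of a rotation step at a neighbour `w` of the moving endpoint. -/
theorem exists_eq_append {q : List V} (hq : IsHamPathAvoiding G x y q) {w : V} (hw : w ≠ x)
    (hz : ∃ z ∈ q.head?, G.Adj z w) :
    ∃ z b a, q = z :: b ++ w :: a ∧ w ∉ z :: b ∧ G.Adj z w := by
  obtain ⟨z, hz, hzw⟩ := hz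
  obtain ⟨b, a, rfl⟩ := List.append_of_mem ((hq.mem_iff w).2 hw)
  have hn := hq.nodup
  have hb : w ∉ b := by grind
  cases b with
  | nil => simp at hz; exact absurd hz.symm hzw.ne
  | cons c b =>
    simp at hz
    subst hz
    exact ⟨c, b, a, rfl, hb, hzw⟩

theorem reverseBefore [DecidableEq V] {q : List V} (hq : IsHamPathAvoiding G x y q) {w : V} (hw : w ≠ x)
    (hz : ∃ z ∈ q.head?, G.Adj z w) :
    IsHamPathAvoiding G x y (q.reverseBefore w) ∧
      (∃ z ∈ (q.reverseBefore w).head?, G.Adj z w) ∧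
      (q.reverseBefore w).reverseBefore w = q := by
  obtain ⟨z, b, a, rfl, hb, hzw⟩ := hq.exists_eq_append hw hz
  have hb' : w ∉ (z :: b).reverse := fun h => hb (List.mem_reverse.1 h)
  rw [List.reverseBefore_append_cons hb, List.reverseBefore_append_cons hb', List.reverse_reverse]
  obtain ⟨h1, h2, h3⟩ := List.isChain_append.1 hq.isChain
  refine ⟨⟨?_, ?_, ?_, ?_⟩, ?_, rfl⟩
  · refine List.isChain_append.2 ⟨?_, h2, ?_⟩
    · rw [List.isChain_reverse]
      exact h1.imp fun _ _ h => h.symm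
    · simpa using hzw
  · refine (List.Perm.nodup_iff ?_).1 hq.nodup
    exact (List.reverse_perm _).symm.append_right _
  · intro v
    rw [← hq.mem_iff v, List.mem_append, List.mem_reverse, List.mem_append]
  · have := hq.getLast?
    rw [List.getLast?_append_of_ne_nil _ (by simp)] at this ⊢
    exact this
  · obtain ⟨l, hl⟩ : ∃ l, (z :: b).getLast? = some l := by simp [List.getLast?_cons]
    refine ⟨l, ?_, h3 l hl w (by simp)⟩
    rw [List.head?_append_of_ne_nil _ (by simp), List.head?_reverse]
    exact hl

theorem eq_cons_cons [Fintype V] [DecidableRel G.Adj] (hcubic : ∀ v, G.degree v = 3)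
    {q : List V} (hq : IsHamPathAvoiding G x y q) : ∃ z p t, q = z :: p :: t := by
  match q, hq with
  | [], hq => simpa using hq.getLast?
  | [z], hq =>
    exfalso
    have h : G.neighborFinset z ⊆ {x} := by
      intro v hv
      have hv := (G.mem_neighborFinset z v).1 hv
      have := hq.mem_iff v
      have := hv.ne
      grind
    have := Finset.card_le_card h
    rw [G.card_neighborFinset_eq_degree, hcubic] at this
    simp at this
  | z :: p :: t, _ => exact ⟨z, p, t, rfl⟩

theorem ne_head {z p : V} {t : List V} (hq : IsHamPathAvoiding G x y (z :: p :: t)) : y ≠ z := by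
  have h1 : y ∈ p :: t := List.mem_of_getLast? (by simpa using hq.getLast?)
  have := hq.nodup
  grind

theorem finite [Finite V] (G : SimpleGraph V) (x y : V) :
    {q | IsHamPathAvoiding G x y q}.Finite := by
  have := Fintype.ofFinite V
  classical
  have hfin : {q : List V | q.Nodup}.Finite :=
    Set.finite_coe_iff.1 (Finite.of_fintype {q : List V // q.Nodup})
  exact hfin.subset fun q hq => hq.nodup

/-- Thomason's lollipop argument for the cubic graph `G`. -/
theorem even_ncard_adj [Fintype V] [DecidableRel G.Adj] (hcubic : ∀ v, G.degree v = 3) (x y : V) :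
    Even {q | IsHamPathAvoiding G x y q ∧ ∃ z ∈ q.head?, G.Adj z x}.ncard := by
  classical
  set S := (finite G x y).toFinset with hS
  have memS : ∀ q, q ∈ S ↔ IsHamPathAvoiding G x y q := by simp [hS]
  set P := (S ×ˢ (Finset.univ : Finset V)).filter
    (fun r => r.2 ≠ x ∧ ∃ z ∈ r.1.head?, G.Adj z r.2) with hP
  have memP : ∀ r, r ∈ P ↔ IsHamPathAvoiding G x y r.1 ∧ r.2 ≠ x ∧
      ∃ z ∈ r.1.head?, G.Adj z r.2 := by
    intro r
    rw [hP, Finset.mem_filter, Finset.mem_product, memS]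
    simp
  have key : ∑ r ∈ P, (if r.1.reverseBefore r.2 = r.1 then 0 else 1 : ZMod 2) = 0 := by
    refine Finset.sum_involution (fun r _ => (r.1.reverseBefore r.2, r.2)) ?_ ?_ ?_ ?_
    · intro r hr
      obtain ⟨h, hx, hz⟩ := (memP r).1 hr
      simp only [(h.reverseBefore hx hz).2.2]
      by_cases h' : r.1.reverseBefore r.2 = r.1
      · simp [h']
      · rw [if_neg h', if_neg (Ne.symm h')]
        decide
    · intro r hr h h'
      exact h (if_pos (congrArg Prod.fst h'))
    · intro r hr
      obtain ⟨h, hx, hz⟩ := (memP r).1 hr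
      have := h.reverseBefore hx hz
      exact (memP _).2 ⟨this.1, hx, this.2.1⟩
    · intro r hr
      obtain ⟨h, hx, hz⟩ := (memP r).1 hr
      exact Prod.ext (h.reverseBefore hx hz).2.2 rfl
  have count : ∀ q ∈ S, ∑ w : V, (if w ≠ x ∧ ∃ z ∈ q.head?, G.Adj z w then
      (if q.reverseBefore w = q then 0 else 1) else 0 : ZMod 2) =
      if ∃ z ∈ q.head?, G.Adj z x then 1 else 0 := by
    intro q hq
    have hq := (memS q).1 hq
    obtain ⟨z, p, t, rfl⟩ := hq.eq_cons_cons hcubic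
    have hzp : G.Adj z p := hq.isChain.rel
    have hpx : p ≠ x := (hq.mem_iff p).1 (by simp)
    have hset : ∀ w, (if w ≠ x ∧ ∃ z' ∈ (z :: p :: t).head?, G.Adj z' w then
        (if (z :: p :: t).reverseBefore w = z :: p :: t then 0 else 1) else 0 : ZMod 2) =
        if w ∈ ((G.neighborFinset z).erase p).erase x then 1 else 0 := by
      intro w
      have hiff : (w ≠ x ∧ G.Adj z w) →
          ((z :: p :: t).reverseBefore w = z :: p :: t ↔ w = p) := fun h =>
        List.reverseBefore_eq_self_iff hq.nodup (by
          have := (hq.mem_iff w).2 h.1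
          have := h.2.ne
          grind)
      simp only [List.head?_cons, Option.mem_some_iff, exists_eq_left', Finset.mem_erase,
        G.mem_neighborFinset]
      by_cases h : w ≠ x ∧ G.Adj z w
      · rw [if_pos h, if_congr (hiff h) rfl rfl]
        by_cases h' : w = p <;> simp [h', h.1, h.2]
      · rw [if_neg h, if_neg (by tauto)]
    rw [Finset.sum_congr rfl fun w _ => hset w]
    rw [Finset.sum_ite_mem, Finset.univ_inter, Finset.sum_const, nsmul_one]
    have hc : ((G.neighborFinset z).erase p).card = 2 := by
      rw [Finset.card_erase_of_mem (by simpa using hzp), G.card_neighborFinset_eq_degree, hcubic]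
    by_cases hzx : G.Adj z x
    · rw [Finset.card_erase_of_mem (by simp [hzx, hpx.symm]), hc]
      simp [hzx]
    · rw [Finset.erase_eq_of_notMem (by simp [hzx]), hc]
      simp only [List.head?_cons, Option.mem_some_iff, exists_eq_left', hzx, if_false]
      decide
  rw [hP, Finset.sum_filter, Finset.sum_product, Finset.sum_congr rfl count,
    ← Finset.sum_filter, Finset.sum_const, nsmul_one, ZMod.natCast_eq_zero_iff_even] at key
  convert key
  rw [← Set.ncard_coe_finset]
  congr 1
  ext q
  simp [memS]

end IsHamPathAvoiding

theorem List.mem_of_mem_zipWith_cons {V : Type*} {u v : V} {l : List V} {e : Sym2 V}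
    (he : e ∈ List.zipWith (s(·, ·)) (u :: l) l) (hv : v ∈ e) : v ∈ u :: l := by
  induction l generalizing u with
  | nil => simp at he
  | cons b l ih =>
    rw [List.zipWith_cons_cons, List.mem_cons] at he
    rcases he with rfl | he
    · rcases Sym2.mem_iff.1 hv with rfl | rfl <;> simp
    · exact List.mem_cons_of_mem _ (ih he)

/-- A vertex list without repetition is determined by its first vertex and the set of pairs of
consecutive vertices. -/
theorem List.eq_of_nodup_of_mem_zipWith_iff {V : Type*} {x : V} {q q' : List V}
    (hn : (x :: q).Nodup) (hn' : (x :: q').Nodup)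
    (h : ∀ e, e ∈ List.zipWith (s(·, ·)) (x :: q) q ↔ e ∈ List.zipWith (s(·, ·)) (x :: q') q') :
    q = q' := by
  induction q generalizing x q' with
  | nil =>
    cases q' with
    | nil => rfl
    | cons b q' => simpa using h s(x, b)
  | cons a q ih =>
    cases q' with
    | nil => simpa using h s(x, a)
    | cons b q' =>
      simp only [List.zipWith_cons_cons, List.mem_cons] at h
      have hx : ∀ e, e ∈ List.zipWith (s(·, ·)) (a :: q) q → x ∉ e := fun e he hxe =>
        (List.nodup_cons.1 hn).1 (List.mem_of_mem_zipWith_cons he hxe)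
      have hx' : ∀ e, e ∈ List.zipWith (s(·, ·)) (b :: q') q' → x ∉ e := fun e he hxe =>
        (List.nodup_cons.1 hn').1 (List.mem_of_mem_zipWith_cons he hxe)
      have hab : a = b := by
        rcases (h s(x, a)).1 (Or.inl rfl) with h1 | h1
        · exact Sym2.congr_right.1 h1
        · exact absurd (Sym2.mem_mk_left x a) (hx' _ h1)
      subst hab
      rw [ih (List.nodup_cons.1 hn).2 (List.nodup_cons.1 hn').2 fun e => ⟨fun he => ?_, fun he => ?_⟩]
      · rcases (h e).1 (Or.inr he) with rfl | h1
        · exact absurd (Sym2.mem_mk_left x a) (hx _ he)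
        · exact h1
      · rcases (h e).2 (Or.inr he) with rfl | h1
        · exact absurd (Sym2.mem_mk_left x a) (hx' _ he)
        · exact h1

/-- The edges of the closed walk from `y` to `x`, then along `q`. -/
def closedEdges {V : Type*} (x y : V) (q : List V) : Set (Sym2 V) :=
  insert s(x, y) {e | e ∈ List.zipWith (s(·, ·)) (x :: q) q}

section

variable {V : Type*} [Fintype V] [DecidableEq V] {G : SimpleGraph V} {x y : V}

theorem exists_isHamiltonianCycle_snd_eq {E : Set (Sym2 V)} (hE : E ∈ HamSets G)
    (he : s(x, y) ∈ E) :
    ∃ c : G.Walk y y, c.IsHamiltonianCycle ∧ c.snd = x ∧ E = {e | e ∈ c.edges} := by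
  obtain ⟨v, w, hw, rfl⟩ := hE
  have hy : y ∈ w.support := hw.mem_support y
  have hc := (Walk.isHamiltonianCycle_rotate hy).2 hw
  have hE : {e | e ∈ w.edges} = {e | e ∈ (w.rotate y hy).edges} := by
    ext e
    exact (w.rotate_edges y hy).mem_iff.symm
  rw [hE] at he ⊢
  generalize w.rotate y hy = c at hc he
  cases c with
  | nil => simpa using hc.isCycle.not_nil
  | @cons _ a _ h p =>
    have hp := ((Walk.cons_isCycle_iff p h).1 hc.isCycle).1
    by_cases hax : a = x
    · exact ⟨_, hc, by simpa using hax, rfl⟩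
    · have hmem : s(y, x) ∈ p.edges := by
        have : s(x, y) ∈ (Walk.cons h p).edges := he
        rw [Walk.edges_cons, List.mem_cons, Sym2.eq_swap] at this
        exact this.resolve_left fun h' => hax (Sym2.congr_right.1 h').symm
      refine ⟨(Walk.cons h p).reverse, ?_, ?_, ?_⟩
      · rw [Walk.isHamiltonianCycle_iff_isCycle_and_length_eq] at hc ⊢
        exact ⟨hc.1.reverse, by rw [Walk.length_reverse, hc.2]⟩
      · rw [Walk.snd_reverse, Walk.penultimate_cons_of_not_nil _ _
          (Walk.not_nil_of_isCycle_cons hc.isCycle)]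
        exact (hp.eq_penultimate_of_mem_edges hmem).symm
      · ext e
        rw [Walk.edges_reverse]
        exact List.mem_reverse.symm

theorem image_closedEdges [DecidableRel G.Adj] (hcubic : ∀ v, G.degree v = 3) (hxy : G.Adj x y) :
    closedEdges x y '' {q | IsHamPathAvoiding G x y q ∧ ∃ z ∈ q.head?, G.Adj z x} =
      {E ∈ HamSets G | s(x, y) ∈ E} := by
  ext E
  constructor
  · rintro ⟨q, ⟨hq, hz⟩, rfl⟩
    refine ⟨?_, Set.mem_insert _ _⟩
    obtain ⟨z, p, t, rfl⟩ := hq.eq_cons_cons hcubic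
    simp only [List.head?_cons, Option.mem_some_iff, exists_eq_left'] at hz
    have hchain : (x :: z :: p :: t).IsChain G.Adj := hq.isChain.cons_cons hz.symm
    obtain ⟨r, hr⟩ : ∃ r : G.Walk x y, r.support = x :: z :: p :: t := by
      have hlast : (x :: z :: p :: t).getLast (by simp) = y := by
        have := hq.getLast?
        rw [List.getLast?_eq_getLast_of_ne_nil (by simp)] at this
        simpa using this
      have hsupp := Walk.support_ofSupport (List.cons_ne_nil x _) hchain
      generalize Walk.ofSupport _ (List.cons_ne_nil x _) hchain = r at hsupp
      exact ⟨r.copy rfl hlast, (Walk.support_copy r rfl hlast).trans hsupp⟩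
    have hnod : (x :: z :: p :: t).Nodup :=
      List.nodup_cons.2 ⟨fun h => (hq.mem_iff x).1 h rfl, hq.nodup⟩
    have hrp : r.IsPath := Walk.IsPath.mk' (hr ▸ hnod)
    have hyz : y ≠ z := hq.ne_head
    have hsnd : r.snd = z := by
      rw [← Walk.support_getElem_one (by simp [hr])]
      simp [hr]
    have hnot : s(y, x) ∉ r.edges := fun h =>
      hyz ((hrp.eq_snd_of_mem_edges (by rwa [Sym2.eq_swap])).trans hsnd)
    refine ⟨y, Walk.cons hxy.symm r,
      Walk.isHamiltonianCycle_iff_isCycle_and_support_count_tail_eq_one.2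
        ⟨(Walk.cons_isCycle_iff _ _).2 ⟨hrp, hnot⟩, fun v => ?_⟩, ?_⟩
    · rw [Walk.support_cons, List.tail_cons, hr]
      refine List.count_eq_one_of_mem hnod ?_
      by_cases hv : v = x
      · simp [hv]
      · exact List.mem_cons_of_mem _ ((hq.mem_iff v).2 hv)
    · ext e
      rw [Set.mem_ofPred_eq, Walk.edges_cons, Walk.edges_eq_zipWith_support, hr, List.mem_cons,
        Sym2.eq_swap]
      rfl
  · rintro ⟨hE, he⟩
    obtain ⟨c, hc, hs, rfl⟩ := exists_isHamiltonianCycle_snd_eq hE he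
    cases c with
    | nil => simpa using hc.isCycle.not_nil
    | @cons _ a _ h p =>
      obtain rfl : a = x := by simpa using hs
      have hp : p.IsPath := ((Walk.cons_isCycle_iff p h).1 hc.isCycle).1
      have hall : ∀ v, v ∈ p.support := fun v => by
        have := (Walk.isHamiltonianCycle_iff_isCycle_and_support_count_tail_eq_one.1 hc).2 v
        rw [Walk.support_cons, List.tail_cons] at this
        exact List.count_pos_iff.1 (this ▸ Nat.one_pos)
      have hsup : p.support = a :: p.support.tail := p.cons_tail_support.symm
      have hnod := hp.support_nodup
      have hch := p.isChain_adj_support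
      have hne : p.support.tail ≠ [] := by
        intro h0
        have := hall y
        rw [hsup, h0] at this
        exact hxy.ne (List.mem_singleton.1 this).symm
      refine ⟨p.support.tail, ⟨⟨hch.tail, hnod.tail, ?_, ?_⟩, ?_⟩, ?_⟩
      · intro v
        have := hall v
        rw [hsup] at this hnod
        grind
      · have h1 : p.support.getLast? = some y := by
          rw [List.getLast?_eq_getLast_of_ne_nil (by simp), Walk.getLast_support]
        rw [hsup] at h1
        rwa [List.getLast?_cons_of_ne_nil hne] at h1
      · obtain ⟨z, t, hzt⟩ := List.exists_cons_of_ne_nil hne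
        rw [hsup, hzt] at hch
        exact ⟨z, by simp [hzt], hch.rel.symm⟩
      · ext e
        rw [Set.mem_ofPred_eq, Walk.edges_cons, Walk.edges_eq_zipWith_support, List.mem_cons,
          Sym2.eq_swap, closedEdges, ← hsup]
        rfl

theorem injOn_closedEdges [DecidableRel G.Adj] (hcubic : ∀ v, G.degree v = 3) :
    Set.InjOn (closedEdges x y) {q | IsHamPathAvoiding G x y q} := by
  have hmem : ∀ q, IsHamPathAvoiding G x y q → (x :: q).Nodup ∧
      s(x, y) ∉ List.zipWith (s(·, ·)) (x :: q) q := by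
    intro q hq
    refine ⟨List.nodup_cons.2 ⟨fun h => (hq.mem_iff x).1 h rfl, hq.nodup⟩, ?_⟩
    obtain ⟨z, p, t, rfl⟩ := hq.eq_cons_cons hcubic
    rw [List.zipWith_cons_cons, List.mem_cons]
    rintro (h | h)
    · exact hq.ne_head (Sym2.congr_right.1 h)
    · exact (hq.mem_iff x).1 (List.mem_of_mem_zipWith_cons h (Sym2.mem_mk_left x y)) rfl
  intro q hq q' hq' h
  obtain ⟨hn, hx⟩ := hmem q hq
  obtain ⟨hn', hx'⟩ := hmem q' hq'
  refine List.eq_of_nodup_of_mem_zipWith_iff hn hn' fun e => ?_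
  have h1 : e ∈ closedEdges x y q ↔ e ∈ closedEdges x y q' := by rw [h]
  by_cases he : e = s(x, y)
  · subst he
    exact ⟨fun h => absurd h hx, fun h => absurd h hx'⟩
  · simpa [closedEdges, he] using h1

end

/-- Smith's theorem: in a finite cubic graph, every edge lies in an even number of
Hamiltonian cycles. -/
theorem smith_even_ham_cycles_through_edge
    {V : Type*} [Fintype V] [DecidableEq V] (G : SimpleGraph V) [DecidableRel G.Adj]
    (hcubic : ∀ v : V, G.degree v = 3) (e : Sym2 V) (he : e ∈ G.edgeSet) :
    Even {E ∈ HamSets G | e ∈ E}.ncard := by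
  induction e with
  | h x y =>
    rw [← image_closedEdges hcubic he,
      ((injOn_closedEdges hcubic).mono fun q hq => hq.1).ncard_image]
    exact IsHamPathAvoiding.even_ncard_adj hcubic x y
end

section
/- Every finite cubic graph that has at least one Hamiltonian cycle has at least three distinct Hamiltonian cycles. -/
open SimpleGraph

/-- The enumeration `σ` of the vertices goes around a Hamiltonian cycle. -/
def IsHamEnum {V : Type*} (G : SimpleGraph V) {m : ℕ} (σ : Fin (m + 3) ≃ V) : Prop :=
  ∀ i, G.Adj (σ i) (σ (i + 1))

/-- The edges of the closed tour that follows the enumeration `σ`. -/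
def tourEdges {V : Type*} {m : ℕ} (σ : Fin (m + 3) ≃ V) : Set (Sym2 V) :=
  Set.range fun i => s(σ i, σ (i + 1))

/-- The enumeration `σ` is a Hamiltonian path. -/
def IsHamPathEnum {V : Type*} (G : SimpleGraph V) {m : ℕ} (σ : Fin (m + 3) ≃ V) : Prop :=
  ∀ i j : Fin (m + 3), j.val = i.val + 1 → G.Adj (σ i) (σ j)

theorem isHamEnum_iff {V : Type*} (G : SimpleGraph V) {m : ℕ} (σ : Fin (m + 3) ≃ V) :
    IsHamEnum G σ ↔ IsHamPathEnum G σ ∧ G.Adj (σ (Fin.last _)) (σ 0) := by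
  constructor
  · intro h
    refine ⟨fun i j hij => ?_, by simpa using h (Fin.last _)⟩
    have hj : j = i + 1 := by
      ext
      rw [Fin.val_add_one, if_neg (by rintro rfl; have := j.2; simp at hij; omega)]
      exact hij
    exact hj ▸ h i
  · rintro ⟨h, h0⟩ i
    by_cases hi : i = Fin.last _
    · subst hi; simpa using h0
    · exact h i (i + 1) (by rw [Fin.val_add_one, if_neg hi])

/-- Reversal of the final segment of positions strictly after `k`. -/
def suffixReverse {m : ℕ} (k : Fin (m + 3)) : Equiv.Perm (Fin (m + 3)) :=
  Function.Involutive.toPerm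
    (fun j => if h : j ≤ k then j else ⟨m + 3 + k.val - j.val, by rw [Fin.le_def] at h; omega⟩)
    (by
      intro j
      by_cases h : j ≤ k
      · simp [h]
      · have h' : ¬ (⟨m + 3 + k.val - j.val, by rw [Fin.le_def] at h; omega⟩ : Fin (m + 3)) ≤ k := by
          rw [Fin.le_def] at h ⊢; simp only; omega
        simp only [h, h', dite_false]
        ext
        simp only
        rw [Fin.le_def] at h; omega)

theorem suffixReverse_val {m : ℕ} (k j : Fin (m + 3)) :
    (suffixReverse k j).val = if j.val ≤ k.val then j.val else m + 3 + k.val - j.val := by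
  by_cases h : j ≤ k
  · rw [if_pos (Fin.le_def.1 h)]
    exact congrArg Fin.val (dif_pos h)
  · rw [if_neg (mt Fin.le_def.2 h)]
    exact congrArg Fin.val (dif_neg h)

theorem suffixReverse_mul_self {m : ℕ} (k : Fin (m + 3)) :
    (suffixReverse k).trans (suffixReverse k) = Equiv.refl _ := by
  ext j
  simp only [Equiv.trans_apply, suffixReverse_val, Equiv.refl_apply]
  split_ifs <;> omega

theorem IsHamPathEnum.trans_suffixReverse {V : Type*} {G : SimpleGraph V} {m : ℕ}
    {σ : Fin (m + 3) ≃ V} (h : IsHamPathEnum G σ) {k : Fin (m + 3)}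
    (hk : G.Adj (σ k) (σ (Fin.last _))) : IsHamPathEnum G ((suffixReverse k).trans σ) := by
  intro i j hij
  simp only [Equiv.trans_apply]
  have hi := suffixReverse_val k i
  have hj := suffixReverse_val k j
  have := j.2
  rcases lt_trichotomy i.val k.val with hlt | heq | hgt
  · apply h
    rw [hi, hj, if_pos (by omega), if_pos (by omega), hij]
  · have e1 : suffixReverse k i = k := by
      ext; rw [hi, if_pos (by omega), heq]
    have e2 : suffixReverse k j = Fin.last _ := by
      ext; rw [hj, if_neg (by omega), Fin.val_last]; omega
    rw [e1, e2]; exact hk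
  · refine (h _ _ ?_).symm
    rw [hi, hj, if_neg (by omega), if_neg (by omega)]; omega

/-- The lollipop graph of Thomason: its vertices are the Hamiltonian paths with first edge `ab`,
and two of them are adjacent when they differ by the reversal of a final segment. -/
def lollipopGraph {V : Type*} (G : SimpleGraph V) (m : ℕ) (a b : V) :
    SimpleGraph {σ : Fin (m + 3) ≃ V // IsHamPathEnum G σ ∧ σ 0 = a ∧ σ 1 = b} where
  Adj σ τ := ∃ k : Fin (m + 3), 1 ≤ k.val ∧ k.val ≤ m ∧ τ.1 = (suffixReverse k).trans σ.1
  symm := ⟨by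
    rintro σ τ ⟨k, h1, h2, h⟩
    refine ⟨k, h1, h2, ?_⟩
    rw [h, ← Equiv.trans_assoc, suffixReverse_mul_self, Equiv.refl_trans]⟩
  loopless := ⟨by
    rintro σ ⟨k, h1, h2, h⟩
    have := congrArg (fun f => f (Fin.last _)) h
    simp only [Equiv.trans_apply, EmbeddingLike.apply_eq_iff_eq] at this
    have := congrArg Fin.val this
    rw [suffixReverse_val, Fin.val_last, if_neg (by omega)] at this
    omega⟩

theorem suffixReverse_injOn {m : ℕ} {k l : Fin (m + 3)} (hk : k.val ≤ m) (hl : l.val ≤ m)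
    (h : suffixReverse k = suffixReverse l) : k = l := by
  have := congrArg (fun f => (f (Fin.last _)).val) h
  simp only [suffixReverse_val, Fin.val_last] at this
  rw [if_neg (by omega), if_neg (by omega)] at this
  ext; omega

open Classical in
theorem degree_lollipopGraph {V : Type*} [Fintype V] (G : SimpleGraph V)
    (hcubic : ∀ v : V, G.degree v = 3) {m : ℕ} {a b : V}
    (σ : {σ : Fin (m + 3) ≃ V // IsHamPathEnum G σ ∧ σ 0 = a ∧ σ 1 = b}) :
    Odd ((lollipopGraph G m a b).degree σ) ↔ G.Adj (σ.1 (Fin.last _)) (σ.1 0) := by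
  obtain ⟨σ, hσ, h0, h1⟩ := σ
  set z := σ (Fin.last _) with hz
  let S : Finset (Fin (m + 3)) :=
    Finset.univ.filter fun k => 1 ≤ k.val ∧ k.val ≤ m ∧ G.Adj (σ k) z
  have hdeg : (lollipopGraph G m a b).degree ⟨σ, hσ, h0, h1⟩ = S.card := by
    rw [← SimpleGraph.card_neighborFinset_eq_degree]
    symm
    refine Finset.card_bij (fun k hk => ⟨(suffixReverse k).trans σ, ?_, ?_, ?_⟩) ?_ ?_ ?_
    · simp only [S, Finset.mem_filter] at hk
      exact hσ.trans_suffixReverse hk.2.2.2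
    · have : suffixReverse k 0 = 0 := by ext; rw [suffixReverse_val]; simp
      simp [this, h0]
    · simp only [S, Finset.mem_filter] at hk
      have : suffixReverse k 1 = 1 := by
        ext; rw [suffixReverse_val, if_pos (by simpa using hk.2.1)]
      simp [this, h1]
    · intro k hk
      simp only [S, Finset.mem_filter] at hk
      rw [SimpleGraph.mem_neighborFinset]
      exact ⟨k, hk.2.1, hk.2.2.1, rfl⟩
    · intro k hk l hl h
      simp only [S, Finset.mem_filter] at hk hl
      refine suffixReverse_injOn hk.2.2.1 hl.2.2.1 ?_
      ext1 x
      have := congrArg (fun f => f x) (Subtype.ext_iff.1 h)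
      simpa using this
    · rintro ⟨τ, hτ, t0, t1⟩ h
      rw [SimpleGraph.mem_neighborFinset] at h
      obtain ⟨k, hk1, hk2, h⟩ := h
      simp only at h
      subst h
      refine ⟨k, ?_, rfl⟩
      simp only [S, Finset.mem_filter, Finset.mem_univ, true_and]
      refine ⟨hk1, hk2, ?_⟩
      have := hτ k ⟨k.val + 1, by omega⟩ rfl
      simp only [Equiv.trans_apply] at this
      have e1 : suffixReverse k k = k := by ext; rw [suffixReverse_val]; simp
      have e2 : suffixReverse k ⟨k.val + 1, by omega⟩ = Fin.last _ := by
        ext; rw [suffixReverse_val]; simp; omega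
      rwa [e1, e2] at this
  let T : Finset (Fin (m + 3)) := Finset.univ.filter fun k => G.Adj (σ k) z
  have hT : T.card = 3 := by
    refine Eq.trans ?_ ((SimpleGraph.card_neighborFinset_eq_degree G z).trans (hcubic z))
    refine Finset.card_bij (fun k _ => σ k) ?_ ?_ ?_
    · intro k hk
      simp only [T, Finset.mem_filter] at hk
      simpa using hk.2.symm
    · intro k _ l _ h
      exact σ.injective h
    · intro v hv
      refine ⟨σ.symm v, ?_, by simp⟩
      simpa [T] using ((G.mem_neighborFinset z v).1 hv).symm
  let p : Fin (m + 3) := ⟨m + 1, by omega⟩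
  have hp : G.Adj (σ p) z := hσ p (Fin.last _) (by simp [p])
  have hSp : p ∉ S := by simp [S, p]
  have hS0 : (0 : Fin (m + 3)) ∉ S := by simp [S]
  have hp0 : (0 : Fin (m + 3)) ≠ p := by simp [p, Fin.ext_iff]
  have key : ∀ k, k ∈ T ↔ k ∈ S ∨ k = p ∨ (k = 0 ∧ G.Adj z (σ 0)) := by
    intro k
    simp only [T, S, Finset.mem_filter, Finset.mem_univ, true_and]
    constructor
    · intro h
      by_cases k0 : k = 0
      · subst k0; exact Or.inr (Or.inr ⟨rfl, h.symm⟩)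
      by_cases kp : k = p
      · exact Or.inr (Or.inl kp)
      have kl : k ≠ Fin.last _ := by rintro rfl; exact G.loopless.irrefl _ h
      left
      rw [Fin.ext_iff, Fin.val_zero] at k0
      rw [Fin.ext_iff] at kp
      rw [Ne, Fin.ext_iff, Fin.val_last] at kl
      change ¬ k.val = m + 1 at kp
      exact ⟨by omega, by omega, h⟩
    · rintro (h | rfl | ⟨rfl, h⟩)
      · exact h.2.2
      · exact hp
      · exact h.symm
  rw [hdeg]
  by_cases h : G.Adj z (σ 0)
  · have : T = insert 0 (insert p S) := by
      ext k; rw [key]; simp only [Finset.mem_insert, h, and_true]; tauto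
    rw [this, Finset.card_insert_of_notMem (by simp [hp0, hS0]),
      Finset.card_insert_of_notMem hSp] at hT
    simp only [h, iff_true]
    rw [show S.card = 1 by omega]; exact odd_one
  · have : T = insert p S := by
      ext k; rw [key]; simp only [Finset.mem_insert, h, and_false, or_false]; tauto
    rw [this, Finset.card_insert_of_notMem hSp] at hT
    simp only [h, iff_false]
    rw [show S.card = 2 by omega]; decide

theorem exists_isHamEnum_ne {V : Type*} [Fintype V] (G : SimpleGraph V) [DecidableRel G.Adj]
    (hcubic : ∀ v : V, G.degree v = 3) {m : ℕ} (σ : Fin (m + 3) ≃ V) (hσ : IsHamEnum G σ) :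
    ∃ τ : Fin (m + 3) ≃ V, IsHamEnum G τ ∧ τ 0 = σ 0 ∧ τ 1 = σ 1 ∧ τ ≠ σ := by
  classical
  rw [isHamEnum_iff] at hσ
  obtain ⟨⟨τ, hτ, t0, t1⟩, hne, hodd⟩ :=
    (lollipopGraph G m (σ 0) (σ 1)).exists_ne_odd_degree_of_exists_odd_degree
      ⟨σ, hσ.1, rfl, rfl⟩
      (by convert (degree_lollipopGraph G (by convert hcubic) ⟨σ, hσ.1, rfl, rfl⟩).2 hσ.2)
  refine ⟨τ, (isHamEnum_iff G τ).2 ⟨hτ, ?_⟩, t0, t1, fun h => hne (Subtype.ext h)⟩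
  exact (degree_lollipopGraph G (by convert hcubic) ⟨τ, hτ, t0, t1⟩).1 (by convert hodd)

theorem eq_of_tourEdges_eq {V : Type*} {m : ℕ} {σ τ : Fin (m + 3) ≃ V} (h0 : τ 0 = σ 0)
    (h1 : τ 1 = σ 1) (h : tourEdges τ = tourEdges σ) : τ = σ := by
  have key : ∀ k : ℕ, ∀ hk : k + 1 < m + 3, τ ⟨k, by omega⟩ = σ ⟨k, by omega⟩ ∧
      τ ⟨k + 1, hk⟩ = σ ⟨k + 1, hk⟩ := by
    intro k
    induction k with
    | zero => exact fun _ => ⟨h0, h1⟩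
    | succ k ih =>
      intro hk
      obtain ⟨ih0, ih1⟩ := ih (by omega)
      refine ⟨ih1, ?_⟩
      have succ_eq : ∀ j (hj : j + 1 < m + 3),
          (⟨j, by omega⟩ : Fin (m + 3)) + 1 = ⟨j + 1, hj⟩ := by
        intro j hj
        ext; rw [Fin.val_add_one, if_neg (by simp [Fin.ext_iff]; omega)]
      have hmem : s(τ ⟨k + 1, by omega⟩, τ ⟨k + 1 + 1, hk⟩) ∈ tourEdges σ := by
        rw [← h, ← succ_eq (k + 1) hk]; exact ⟨_, rfl⟩
      obtain ⟨j, hj⟩ := hmem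
      simp only [Sym2.eq_iff] at hj
      rcases hj with ⟨e1, e2⟩ | ⟨e1, e2⟩
      · rw [ih1, EmbeddingLike.apply_eq_iff_eq] at e1
        subst e1
        rw [← e2, succ_eq]
      · rw [ih1, EmbeddingLike.apply_eq_iff_eq, ← succ_eq k (by omega), add_left_inj] at e2
        rw [e2, ← ih0, EmbeddingLike.apply_eq_iff_eq, Fin.ext_iff] at e1
        simp only at e1
        omega
  ext1 ⟨i, hi⟩
  rcases i with _ | i
  · exact h0
  · exact (key i hi).2

theorem mem_hamSets_iff {V : Type*} [Fintype V] [DecidableEq V] (G : SimpleGraph V) {m : ℕ}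
    (hm : Fintype.card V = m + 3) (E : Set (Sym2 V)) :
    E ∈ HamSets G ↔ ∃ σ : Fin (m + 3) ≃ V, IsHamEnum G σ ∧ tourEdges σ = E := by
  constructor
  · rintro ⟨v, w, hw, rfl⟩
    have hlen : w.length = m + 3 := hw.length_eq.trans hm
    have hinj : Function.Injective fun i : Fin (m + 3) => w.getVert i.val := by
      intro i j h
      exact Fin.ext (hw.isCycle.getVert_injOn' (by simp; omega) (by simp; omega) h)
    let σ : Fin (m + 3) ≃ V := Equiv.ofBijective _
      ((Fintype.bijective_iff_injective_and_card _).2 ⟨hinj, by simp [hm]⟩)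
    have hs : ∀ i : Fin (m + 3), σ (i + 1) = w.getVert (i.val + 1) := by
      intro i
      change w.getVert (i + 1 : Fin (m + 3)).val = _
      rw [Fin.val_add_one]
      split_ifs with h
      · subst h
        simp [← hlen]
      · rfl
    refine ⟨σ, fun i => ?_, ?_⟩
    · rw [hs]; exact w.adj_getVert_succ (by omega)
    · ext e
      induction e using Sym2.ind with
      | _ x y =>
      rw [Set.mem_ofPred_eq, SimpleGraph.Walk.mk_mem_edges_iff_exists]
      constructor
      · rintro ⟨i, hi⟩
        exact ⟨i.val, by omega, by rw [← hi]; simp only [hs]; rfl⟩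
      · rintro ⟨i, hi, h⟩
        exact ⟨⟨i, by omega⟩, by rw [← h]; simp only [hs]; rfl⟩
  · rintro ⟨σ, hσ, rfl⟩
    let f : SimpleGraph.cycleGraph (m + 3) →g G := ⟨σ, by
      intro i j hij
      rcases SimpleGraph.cycleGraph_adj.1 hij with h | h
      · rw [sub_eq_iff_eq_add'] at h
        rw [h]
        exact (hσ j).symm
      · rw [sub_eq_iff_eq_add'] at h
        rw [h]
        exact hσ i⟩
    refine ⟨f 0, (SimpleGraph.cycleGraph.cycle m).map f, ?_, ?_⟩
    · rw [SimpleGraph.Walk.isHamiltonianCycle_iff_isCycle_and_length_eq]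
      refine ⟨(SimpleGraph.Walk.isCycle_map_iff_of_injective σ.injective).2
        SimpleGraph.cycleGraph.isCycle_cycle, by simp [hm]⟩
    · have hmem : ∀ i : Fin (m + 3), s(i, i + 1) ∈ (SimpleGraph.cycleGraph.cycle m).edges := by
        intro i
        rw [SimpleGraph.Walk.mk_mem_edges_iff_exists]
        refine ⟨m + 2 - i.val, by simp; omega, ?_⟩
        rw [SimpleGraph.cycleGraph.getVert_cycle (by omega),
          SimpleGraph.cycleGraph.getVert_cycle (by omega), Sym2.eq_swap]
        congr 2
        · rw [show m + 3 - (m + 2 - i.val + 1) = i.val by omega, Nat.mod_eq_of_lt i.2]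
        · rw [show m + 3 - (m + 2 - i.val) = i.val + 1 by omega]
          simp
      ext e
      rw [Set.mem_ofPred_eq, SimpleGraph.Walk.edges_map, List.mem_map]
      constructor
      · rintro ⟨i, rfl⟩
        exact ⟨_, hmem i, rfl⟩
      · rintro ⟨d, hd, rfl⟩
        have hd' := SimpleGraph.Walk.edges_subset_edgeSet _ hd
        induction d using Sym2.ind with
        | _ x y =>
        rcases SimpleGraph.cycleGraph_adj.1 hd' with h | h
        · rw [sub_eq_iff_eq_add'] at h
          simp only at h
          exact ⟨y, by rw [h, Sym2.eq_swap]; rfl⟩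
        · rw [sub_eq_iff_eq_add'] at h
          simp only at h
          exact ⟨x, by rw [h]; rfl⟩

theorem ncard_of_mem_hamSets {V : Type*} [Fintype V] [DecidableEq V] {G : SimpleGraph V}
    {E : Set (Sym2 V)} (hE : E ∈ HamSets G) : E.ncard = Fintype.card V := by
  obtain ⟨v, w, hw, rfl⟩ := hE
  rw [← hw.length_eq, ← w.length_edges, ← List.toFinset_card_of_nodup hw.isCycle.edges_nodup,
    ← Set.ncard_coe_finset, List.coe_toFinset]

/-- Each edge of a Hamiltonian cycle of a cubic graph lies in another Hamiltonian cycle. -/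
theorem exists_hamSets_ne_of_mem {V : Type*} [Fintype V] [DecidableEq V] (G : SimpleGraph V)
    [DecidableRel G.Adj] (hcubic : ∀ v : V, G.degree v = 3) {E : Set (Sym2 V)}
    (hE : E ∈ HamSets G) {e : Sym2 V} (he : e ∈ E) : ∃ F ∈ HamSets G, F ≠ E ∧ e ∈ F := by
  obtain ⟨m, hm⟩ : ∃ m, Fintype.card V = m + 3 := by
    obtain ⟨v, w, hw, -⟩ := hE
    exact ⟨Fintype.card V - 3, by have := hw.isCycle.three_le_length; have := hw.length_eq; omega⟩
  obtain ⟨ρ, hρ, rfl⟩ := (mem_hamSets_iff G hm E).1 hE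
  obtain ⟨i, rfl⟩ := he
  let σ : Fin (m + 3) ≃ V := (Equiv.addLeft i).trans ρ
  have hσ : IsHamEnum G σ := fun j => by
    simpa [σ, add_assoc] using hρ (i + j)
  have hσρ : tourEdges σ = tourEdges ρ := by
    ext e
    constructor
    · rintro ⟨j, rfl⟩
      exact ⟨i + j, by simp [σ, add_assoc]⟩
    · rintro ⟨j, rfl⟩
      exact ⟨-i + j, by simp [σ, ← add_assoc]⟩
  obtain ⟨τ, hτ, h0, h1, hne⟩ := exists_isHamEnum_ne G hcubic σ hσ
  refine ⟨tourEdges τ, (mem_hamSets_iff G hm _).2 ⟨τ, hτ, rfl⟩, ?_, 0, ?_⟩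
  · rw [← hσρ]
    exact fun h => hne (eq_of_tourEdges_eq h0 h1 h)
  · simp [h0, h1, σ]

/-- A finite cubic graph with a Hamiltonian cycle has at least three distinct
Hamiltonian cycles. -/
theorem cubic_three_ham_cycles
    {V : Type*} [Fintype V] [DecidableEq V] (G : SimpleGraph V) [DecidableRel G.Adj]
    (hcubic : ∀ v : V, G.degree v = 3) (hne : (HamSets G).Nonempty) :
    3 ≤ (HamSets G).ncard := by
  obtain ⟨C, hC⟩ := hne
  obtain ⟨e, he⟩ : C.Nonempty := by
    obtain ⟨v, -⟩ := id hC
    have : Nonempty V := ⟨v⟩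
    rw [← Set.ncard_pos, ncard_of_mem_hamSets hC]
    exact Fintype.card_pos
  obtain ⟨D, hD, hDC, -⟩ := exists_hamSets_ne_of_mem G hcubic hC he
  obtain ⟨f, hf, hfD⟩ : ∃ f ∈ C, f ∉ D := by
    by_contra! h
    refine hDC (Set.eq_of_subset_of_ncard_le h ?_).symm
    rw [ncard_of_mem_hamSets hC, ncard_of_mem_hamSets hD]
  obtain ⟨F, hF, hFC, hfF⟩ := exists_hamSets_ne_of_mem G hcubic hC hf
  have hFD : F ≠ D := by rintro rfl; exact hfD hfF
  exact (Set.two_lt_ncard (Set.toFinite _)).2 ⟨C, hC, D, hD, F, hF, hDC.symm, hFC.symm, hFD.symm⟩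
end

section
/- Label the horizontal edges of the Möbius ladder M4 cyclically with the pattern ℓ, t, ℓ, t, ℓ, t, ℓ, t (edge {i,i+1 mod 8} labeled ℓ if i is even and t if i is odd) and label all rungs 𝓛. Then no Hamiltonian cycle of M4 contains two rungs joined by a single horizontal edge labeled t (i.e., no Hamiltonian cycle contains a path of the form 𝓛–t–𝓛). -/
open SimpleGraph

namespace SimpleGraph.Walk

variable {V : Type*} {G : SimpleGraph V} {v : V} {w : G.Walk v v}

/-- Two edges of a cycle at a vertex are all the edges of the cycle at that vertex. -/
lemma IsCycle.eq_or_eq_of_mem_edges (hw : w.IsCycle) {a b c d : V} (hbc : b ≠ c)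
    (hb : s(a, b) ∈ w.edges) (hc : s(a, c) ∈ w.edges) (hd : s(a, d) ∈ w.edges) :
    d = b ∨ d = c := by
  have hcard := hw.ncard_neighborSet_toSubgraph_eq_two (w.fst_mem_support_of_mem_edges hb)
  have hsub : ({b, c} : Set V) ⊆ w.toSubgraph.neighborSet a := by
    rintro x (rfl | rfl) <;> simpa [adj_toSubgraph_iff_mem_edges]
  have heq := Set.eq_of_subset_of_ncard_le hsub (by rw [hcard, Set.ncard_pair hbc])
    (Set.finite_of_ncard_ne_zero (by simp [hcard]))
  have hmem : d ∈ w.toSubgraph.neighborSet a := by simpa [adj_toSubgraph_iff_mem_edges]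
  simpa [← heq] using hmem

/-- A cycle through `a` uses both `b` and `c` next if no other neighbor of `a` is available. -/
lemma IsCycle.mem_edges_of_forall_eq_or_eq (hw : w.IsCycle) {a b c : V} (ha : a ∈ w.support)
    (h : ∀ d, s(a, d) ∈ w.edges → d = b ∨ d = c) :
    s(a, b) ∈ w.edges ∧ s(a, c) ∈ w.edges := by
  have hcard := hw.ncard_neighborSet_toSubgraph_eq_two ha
  have hsub : w.toSubgraph.neighborSet a ⊆ {b, c} := fun d hd ↦
    h d (by simpa [adj_toSubgraph_iff_mem_edges] using hd)
  have hle : ({b, c} : Set V).ncard ≤ (w.toSubgraph.neighborSet a).ncard :=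
    (Set.ncard_insert_le b {c}).trans (by simp [hcard])
  have heq := Set.eq_of_subset_of_ncard_le hsub hle
  constructor <;> rw [← adj_toSubgraph_iff_mem_edges, ← Subgraph.mem_neighborSet, heq] <;> simp

/-- A closed walk that meets both a set and its complement has an edge leaving the set. -/
lemma exists_mem_edges_boundary {x y : V} (hx : x ∈ w.support) (hy : y ∈ w.support) (S : Set V)
    (hxS : x ∈ S) (hyS : y ∉ S) : ∃ a ∈ S, ∃ b ∉ S, s(a, b) ∈ w.edges := by
  classical
  have hy' : y ∈ (w.rotate x hx).support := by simpa using hy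
  obtain ⟨d, hd, hfst, hsnd⟩ :=
    ((w.rotate x hx).takeUntil y hy').exists_boundary_dart S hxS hyS
  refine ⟨d.fst, hfst, d.snd, hsnd, ?_⟩
  have hmem := (w.rotate x hx).edges_takeUntil_subset_edges hy' (List.mem_map_of_mem hd)
  exact (w.rotate_edges x hx).mem_iff.mp hmem

end SimpleGraph.Walk

lemma M4_adj_iff (a b : Fin 8) : M4.Adj a b ↔ b = a + 1 ∨ b = a + 7 ∨ b = a + 4 := by
  simp only [M4, fromRel_adj]
  decide +revert

/-- No Hamiltonian cycle of `M4` contains a path of the form `𝓛–t–𝓛`: two rungs joined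
by a single `t`-labeled horizontal edge (horizontal edge `{i, i+1}` with `i` odd). -/
theorem no_ham_cycle_L_t_L :
    ¬ ∃ E : Set (Sym2 (Fin 8)), IsHamEdgeSet E ∧
      ∃ i : Fin 8, Odd i.val ∧ s(i, i + 1) ∈ E ∧ s(i, i + 4) ∈ E ∧ s(i + 1, i + 5) ∈ E := by
  rintro ⟨_, ⟨v, w, hw, rfl⟩, i, -, h01, h04, h15⟩
  simp only [Set.mem_ofPred_eq] at h01 h04 h15
  have hc := hw.isCycle
  have nbr {a b : Fin 8} (h : s(a, b) ∈ w.edges) : b = a + 1 ∨ b = a + 7 ∨ b = a + 4 :=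
    (M4_adj_iff a b).mp (w.adj_of_mem_edges h)
  have h10 : s(i + 1, i) ∈ w.edges := Sym2.eq_swap ▸ h01
  have h07 : s(i, i + 7) ∉ w.edges := fun h ↦ by
    have := hc.eq_or_eq_of_mem_edges (by lia) h01 h04 h
    lia
  have h12 : s(i + 1, i + 2) ∉ w.edges := fun h ↦ by
    have := hc.eq_or_eq_of_mem_edges (by lia) h10 h15 h
    lia
  obtain ⟨h76, h73⟩ := hc.mem_edges_of_forall_eq_or_eq (a := i + 7) (b := i + 6) (c := i + 3)
    (hw.mem_support _) fun d hd ↦ by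
      have : d ≠ i := by rintro rfl; exact h07 (Sym2.eq_swap ▸ hd)
      have := nbr hd
      lia
  obtain ⟨h23, h26⟩ := hc.mem_edges_of_forall_eq_or_eq (a := i + 2) (b := i + 3) (c := i + 6)
    (hw.mem_support _) fun d hd ↦ by
      have : d ≠ i + 1 := by rintro rfl; exact h12 (Sym2.eq_swap ▸ hd)
      have := nbr hd
      lia
  rw [Sym2.eq_swap] at h76 h73
  -- The edges found so far close up into a 4-cycle, which the Hamiltonian cycle cannot leave.
  obtain ⟨a, ha, b, hb, hab⟩ := Walk.exists_mem_edges_boundary (hw.mem_support (i + 2))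
    (hw.mem_support i) {i + 2, i + 3, i + 6, i + 7} (by simp) (by simp)
  simp only [Set.mem_insert_iff, Set.mem_singleton_iff, not_or] at ha hb
  have hn := nbr hab
  obtain rfl | rfl | rfl | rfl := ha
  · have : b ≠ i + 1 := by rintro rfl; exact h12 (Sym2.eq_swap ▸ hab)
    lia
  · have := hc.eq_or_eq_of_mem_edges (by lia) h73 (Sym2.eq_swap ▸ h23) hab
    lia
  · have := hc.eq_or_eq_of_mem_edges (by lia) h76 (Sym2.eq_swap ▸ h26) hab
    lia
  · have : b ≠ i := by rintro rfl; exact h07 (Sym2.eq_swap ▸ hab)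
    lia
end
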